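/- arXiv:1401.1466 — 3 statements merged into one kernel-verified Lean document; each statement's English description precedes it below -/
import Mathlib

section
/- For prime powers p ≤ q ≤ r, one has N(pqr) ≥ p. -/
/-- A latin square of order `n`: an `n × n` array with entries from an `n`-element
symbol set such that every row and every column contains each symbol exactly once. -/
def IsLatinSquare {n : ℕ} (L : Fin n → Fin n → Fin n) : Prop :=
  (∀ i, Function.Bijective fun j => L i j) ∧ (∀ j, Function.Bijective fun i => L i j)

/-- Two latin squares of order `n` are orthogonal if the `n²` superimposed
ordered pairs of entries are all distinct. -/
def AreOrthogonal {n : ℕ} (L M : Fin n → Fin n → Fin n) : Prop :=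
  Function.Injective fun p : Fin n × Fin n => (L p.1 p.2, M p.1 p.2)

/-- There exist `r` mutually orthogonal latin squares (MOLS) of order `n`. -/
def HasMOLS (n r : ℕ) : Prop :=
  ∃ L : Fin r → Fin n → Fin n → Fin n,
    (∀ s, IsLatinSquare (L s)) ∧ ∀ s t : Fin r, s ≠ t → AreOrthogonal (L s) (L t)

/-- `molsNum n` is `N(n)`, the maximum size of a set of MOLS of order `n`. -/
noncomputable def molsNum (n : ℕ) : ℕ := sSup {r | HasMOLS n r}

/-- A transversal design with groups indexed by `K`, points `M`, blocks `I`,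
whose blocks are resolved into classes through slots `S` and the class map `cl`. -/
def RT (K M I : Type) {S J : Type} (cl : S → J) : Prop :=
  Nat.card I = Nat.card M ^ 2 ∧ ∃ (f : K → I → M) (l : K → I → S),
    (∀ i b b', f i b = f i b' → l i b = l i b' → b = b') ∧
    (∀ i i' b, cl (l i b) = cl (l i' b)) ∧
    ∀ i i', i ≠ i' → ∀ b b', f i b = f i b' → f i' b = f i' b' → b = b'

theorem RT.regroup {K M I S J S' J' : Type} {cl : S → J} (h : RT K M I cl)
    (cl' : S' → J') (e : S → S') (he : Function.Injective e) (g : J → J')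
    (hg : ∀ s, cl' (e s) = g (cl s)) : RT K M I cl' := by
  obtain ⟨hc, f, l, h1, h2, h3⟩ := h
  refine ⟨hc, f, fun i b => e (l i b), fun i b b' hb hb' => h1 i b b' hb (he hb'), ?_, h3⟩
  intro i i' b
  simp only [hg, h2 i i' b]

theorem RT.plane (F : Type) [Field F] [Finite F] :
    RT (Option F) F (F × F) (fun _ : F => ()) := by
  refine ⟨by rw [Nat.card_prod, sq], fun i b => i.elim b.1 (fun x => b.1 * x + b.2),
    fun i b => i.elim b.2 (fun _ => b.1), ?_, fun _ _ _ => rfl, ?_⟩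
  · rintro (_ | i) ⟨u, v⟩ ⟨u', v'⟩ h h' <;> simp at h h' ⊢
    · exact ⟨h, h'⟩
    · subst h'; simpa using h
  · rintro (_ | i) (_ | j) hij ⟨u, v⟩ ⟨u', v'⟩ h h' <;> simp at hij h h' ⊢
    · subst h; simpa using h'
    · subst h'; simpa using h
    · have h4 : (u - u') * (i - j) = 0 := by linear_combination h - h'
      have h5 : u = u' := by
        rcases mul_eq_zero.1 h4 with h | h
        · exact sub_eq_zero.1 h
        · exact absurd (sub_eq_zero.1 h) hij
      subst h5; simpa using h

theorem RT.lin {K : Type} (F : Type) [Field F] [Finite F] (t : K → F)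
    (ht : Function.Injective t) : RT K F (F × F) (id : F → F) := by
  refine ⟨by rw [Nat.card_prod, sq], fun i b => b.1 * t i + b.2, fun i b => b.1, ?_,
    fun _ _ _ => rfl, ?_⟩
  · rintro i ⟨u, v⟩ ⟨u', v'⟩ h h'
    simp at h h' ⊢
    subst h'; simpa using h
  · rintro i j hij ⟨u, v⟩ ⟨u', v'⟩ h h'
    simp at h h' ⊢
    have h4 : (u - u') * (t i - t j) = 0 := by linear_combination h - h'
    have h5 : u = u' := by
      rcases mul_eq_zero.1 h4 with h | h
      · exact sub_eq_zero.1 h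
      · exact absurd (ht (sub_eq_zero.1 h)) hij
    subst h5; simpa using h

/-- shift of a point of the second factor according to the slot of the first -/
def slotShift {A B G : Type} [AddGroup G] : A × G ⊕ B → G → G
  | Sum.inl x, y => y + x.2
  | Sum.inr _, y => y

/-- the slot of a product block -/
def slotMk {A B G I T : Type} : A × G ⊕ B → I → T → A × I ⊕ B × T
  | Sum.inl x, c, _ => Sum.inl (x.1, c)
  | Sum.inr b, _, t => Sum.inr (b, t)

theorem slotShift_inj {A B G : Type} [AddGroup G] (s : A × G ⊕ B) {y y' : G}
    (h : slotShift s y = slotShift s y') : y = y' := by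
  rcases s with s | s <;> simpa [slotShift] using h

/-- Rees' product construction. -/
theorem RT.rees {K M I A B G I2 T J2 : Type} [AddGroup G] {τ : T → J2}
    (h : RT K M I (Sum.map Prod.fst id : A × G ⊕ B → A ⊕ B)) (h' : RT K G I2 τ) :
    RT K (M × G) (I × I2)
      (Sum.map id (Prod.map id τ) : A × I2 ⊕ B × T → A × I2 ⊕ B × J2) := by
  obtain ⟨hc, f, l, h1, h2, h3⟩ := h
  obtain ⟨hc', f', l', h1', h2', h3'⟩ := h'
  refine ⟨by rw [Nat.card_prod, Nat.card_prod, hc, hc', mul_pow],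
    fun i b => (f i b.1, slotShift (l i b.1) (f' i b.2)),
    fun i b => slotMk (l i b.1) b.2 (l' i b.2), ?_, ?_, ?_⟩
  · rintro i ⟨b, c⟩ ⟨b', c'⟩ hf hl
    have hb := h1 i b b'
    have hcc := h1' i c c'
    simp only [Prod.mk.injEq] at hf hl ⊢
    obtain ⟨hf1, hf2⟩ := hf
    replace hb := hb hf1
    rcases hs : l i b with ⟨a, x⟩ | x <;> rcases hs' : l i b' with ⟨a', x'⟩ | x' <;>
      simp [hs, hs', slotShift, slotMk] at hb hf2 hl
    · obtain ⟨rfl, rfl⟩ := hl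
      exact ⟨hb rfl (by simpa using hf2), rfl⟩
    · exact ⟨hb hl.1, hcc hf2 hl.2⟩
  · rintro i i' ⟨b, c⟩
    have hb := h2 i i' b
    have hcc := h2' i i' c
    simp only
    rcases hs : l i b with ⟨a, x⟩ | x <;> rcases hs' : l i' b with ⟨a', x'⟩ | x' <;>
      simp [hs, hs', slotMk] at hb ⊢
    · exact hb
    · exact ⟨hb, hcc⟩
  · rintro i i' hi ⟨b, c⟩ ⟨b', c'⟩ hf hf'
    simp only [Prod.mk.injEq] at hf hf' ⊢
    have hb := h3 i i' hi b b' hf.1 hf'.1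
    subst hb
    exact ⟨rfl, h3' i i' hi c c' (slotShift_inj _ hf.2) (slotShift_inj _ hf'.2)⟩

theorem hasMOLS_of_oa {I : Type} {n k : ℕ} (hI : Nat.card I = n ^ 2) (hn : 0 < n)
    (f : Fin (k + 2) → I → Fin n)
    (hf : ∀ i j, i ≠ j → ∀ b b', f i b = f i b' → f j b = f j b' → b = b') :
    HasMOLS n k := by
  have : Finite I := Nat.finite_of_card_ne_zero (by rw [hI]; positivity)
  have hbij : Function.Bijective (fun b : I => (f 0 b, f 1 b)) := by
    rw [Nat.bijective_iff_injective_and_card]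
    refine ⟨fun b b' h => ?_, by simp [hI, sq]⟩
    simp only [Prod.mk.injEq] at h
    exact hf 0 1 (by simp) b b' h.1 h.2
  let E := Equiv.ofBijective _ hbij
  have E0 : ∀ x, f 0 (E.symm x) = x.1 := fun x => congrArg Prod.fst (E.apply_symm_apply x)
  have E1 : ∀ x, f 1 (E.symm x) = x.2 := fun x => congrArg Prod.snd (E.apply_symm_apply x)
  refine ⟨fun s i j => f s.succ.succ (E.symm (i, j)), fun s => ⟨fun i => ?_, fun j => ?_⟩, ?_⟩
  · apply Finite.injective_iff_bijective.1
    intro j j' h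
    have := hf 0 s.succ.succ (by simp [Fin.ext_iff]) _ _ (by rw [E0, E0]) h
    simpa using this
  · apply Finite.injective_iff_bijective.1
    intro j j' h
    have := hf 1 s.succ.succ (by simp [Fin.ext_iff]) _ _ (by rw [E1, E1]) h
    simpa using this
  · rintro s t hst x y h
    simp only [Prod.mk.injEq] at h
    have := hf s.succ.succ t.succ.succ (by simpa using hst) _ _ h.1 h.2
    simpa using this

theorem RT.hasMOLS {K M I S J : Type} {cl : S → J} (h : RT K M I cl)
    (hcl : Function.Injective cl) {n k : ℕ} (hM : Nat.card M = n) (hn : 0 < n)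
    (hS : Nat.card S = n) (hK : Nat.card K = k + 1) : HasMOLS n k := by
  obtain ⟨hc, f, l, h1, h2, h3⟩ := h
  have : Finite M := Nat.finite_of_card_ne_zero (by omega)
  have : Finite S := Nat.finite_of_card_ne_zero (by omega)
  have : Finite K := Nat.finite_of_card_ne_zero (by omega)
  let eM := Finite.equivFinOfCardEq hM
  let eS := Finite.equivFinOfCardEq hS
  let eK := Finite.equivFinOfCardEq hK
  have hl : ∀ i i' b, l i b = l i' b := fun i i' b => hcl (h2 i i' b)
  refine hasMOLS_of_oa (I := I) (by rw [hc, hM]) hn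
    (Fin.cons (fun b => eS (l (eK.symm 0) b)) (fun i b => eM (f (eK.symm i) b))) ?_
  intro i j hij b b'
  induction i using Fin.cases with
  | zero =>
    induction j using Fin.cases with
    | zero => exact absurd rfl hij
    | succ j =>
      simp only [Fin.cons_zero, Fin.cons_succ, EmbeddingLike.apply_eq_iff_eq]
      intro h h'
      refine h1 _ b b' h' ?_
      rw [hl _ (eK.symm 0), h, hl]
  | succ i =>
    induction j using Fin.cases with
    | zero =>
      simp only [Fin.cons_zero, Fin.cons_succ, EmbeddingLike.apply_eq_iff_eq]
      intro h' h
      refine h1 _ b b' h' ?_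
      rw [hl _ (eK.symm 0), h, hl]
    | succ j =>
      simp only [Fin.cons_succ, EmbeddingLike.apply_eq_iff_eq]
      exact h3 _ _ (by simpa using hij) b b'

theorem HasMOLS.le {n r : ℕ} (hn : 2 ≤ n) (h : HasMOLS n r) : r ≤ n := by
  obtain ⟨L, h1, h2⟩ := h
  let z : Fin n := ⟨0, by omega⟩
  let o : Fin n := ⟨1, by omega⟩
  have key : ∀ s, ∃ j, L s o j = L s z z := fun s => ((h1 s).1 o).2 _
  choose j hj using key
  have hinj : Function.Injective j := by
    intro s t hst
    by_contra hne
    have := @h2 s t hne (o, j s) (z, z) (by simp only [hj]; rw [hst, hj])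
    simp [z, o] at this
  simpa using Fintype.card_le_of_injective j hinj

theorem le_molsNum {n r : ℕ} (hn : 2 ≤ n) (h : HasMOLS n r) : r ≤ molsNum n :=
  le_csSup ⟨n, fun _ h => HasMOLS.le hn h⟩ h

theorem exists_field {p : ℕ} (hp : IsPrimePow p) :
    ∃ (F : Type) (_ : Field F), Finite F ∧ Nat.card F = p := by
  have h : Nonempty (Field (Fin p)) := by
    rw [Fintype.nonempty_field_iff]; simpa using hp
  obtain ⟨h⟩ := h
  exact ⟨Fin p, h, inferInstance, by simp⟩

theorem exists_inj {X Y : Type} [Finite X] [Finite Y] (h : Nat.card X ≤ Nat.card Y) :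
    ∃ f : X → Y, Function.Injective f := by
  have := Fintype.ofFinite X
  have := Fintype.ofFinite Y
  rw [Nat.card_eq_fintype_card, Nat.card_eq_fintype_card] at h
  obtain ⟨f⟩ := Function.Embedding.nonempty_of_card_le h
  exact ⟨f, f.injective⟩

theorem exists_equiv {X Y : Type} [Finite X] [Finite Y] (h : Nat.card X = Nat.card Y) :
    Nonempty (X ≃ Y) :=
  ⟨(Finite.equivFinOfCardEq h).trans (Finite.equivFin Y).symm⟩

theorem hasMOLS_primePow {n k : ℕ} (hn : IsPrimePow n) (hk : k + 1 ≤ n) : HasMOLS n k := by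
  obtain ⟨F, _, _, hF⟩ := exists_field hn
  obtain ⟨t, ht⟩ := exists_inj (X := Fin (k + 1)) (Y := F) (by simpa [hF] using hk)
  exact (RT.lin F t ht).hasMOLS Function.injective_id hF (by omega) hF (by simp)

theorem hasMOLS_mul {m n k : ℕ} (hm : IsPrimePow m) (hn : IsPrimePow n) (hk : k + 1 ≤ n)
    (hk' : k + 1 ≤ m) : HasMOLS (m * n) k := by
  obtain ⟨F, _, _, hF⟩ := exists_field hn
  obtain ⟨t, ht⟩ := exists_inj (X := Fin (k + 1)) (Y := F) (by simpa [hF] using hk)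
  obtain ⟨E, _, _, hE⟩ := exists_field hm
  obtain ⟨u, hu⟩ := exists_inj (X := Fin (k + 1)) (Y := E) (by simpa [hE] using hk')
  have h := (RT.lin E u hu).regroup (Sum.map Prod.fst id : Empty × F ⊕ E → Empty ⊕ E)
    Sum.inr Sum.inr_injective Sum.inr (fun _ => rfl)
  refine (h.rees (RT.lin F t ht)).hasMOLS ?_ (by rw [Nat.card_prod, hF, hE])
    (Nat.mul_pos (by omega) (by omega)) (by simp [Nat.card_sum, Nat.card_prod, hF, hE]) (by simp)
  simpa using Function.injective_id

theorem hasMOLS_main {p q r : ℕ} (hp : IsPrimePow p) (hq : IsPrimePow q) (hr : IsPrimePow r)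
    (hpq : p < q) (hqr : q ≤ r) : HasMOLS (p * q * r) p := by
  have hp0 : 0 < p := hp.pos
  obtain ⟨P, _, _, hP⟩ := exists_field hp
  obtain ⟨Q, _, _, hQ⟩ := exists_field hq
  obtain ⟨R, _, _, hR⟩ := exists_field hr
  have hK : Nat.card (Option P) = p + 1 := by rw [Finite.card_option, hP]
  obtain ⟨tQ, htQ⟩ := exists_inj (X := Option P) (Y := Q) (by omega)
  obtain ⟨tR, htR⟩ := exists_inj (X := Option P) (Y := R) (by omega)
  obtain ⟨a, s, hs, hras⟩ : ∃ a s, s < p ∧ r = a * p + s :=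
    ⟨r / p, r % p, Nat.mod_lt _ hp0, by rw [mul_comm, Nat.div_add_mod]⟩
  obtain ⟨d, hd⟩ := Nat.exists_eq_add_of_lt hpq
  have hle : s * (d + 1) ≤ a * (p * p) := by
    have h1 : s * q ≤ p * r := Nat.mul_le_mul hs.le hqr
    subst hd
    rw [hras] at h1
    nlinarith
  obtain ⟨z, hz⟩ := Nat.exists_eq_add_of_le hle
  obtain ⟨e1⟩ : Nonempty (R ≃ Fin a × P ⊕ Fin s) := exists_equiv (by
    simp [Nat.card_sum, Nat.card_prod, hP, hR, hras])
  have d1 := (RT.lin R tR htR).regroup (Sum.map Prod.fst id : Fin a × P ⊕ Fin s → Fin a ⊕ Fin s)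
    e1 e1.injective (fun x => Sum.map Prod.fst id (e1 x)) (fun _ => rfl)
  have d2 := d1.rees (RT.plane P)
  obtain ⟨e2⟩ : Nonempty (Fin a × (P × P) ≃ (Fin s × Fin (d + 1)) ⊕ Fin z) := exists_equiv (by
    simp [Nat.card_sum, Nat.card_prod, hP, hz])
  obtain ⟨w⟩ : Nonempty (P ⊕ Fin (d + 1) ≃ Q) := exists_equiv (by
    simp [Nat.card_sum, hP, hQ, hd]; omega)
  let e3 : (Fin s × Fin (d + 1)) ⊕ Fin z → Fin s × Q ⊕ Fin z :=
    Sum.map (fun x => (x.1, w (Sum.inr x.2))) id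
  let e4 : Fin a × (P × P) ⊕ Fin s × P → Fin s × Q ⊕ Fin z :=
    Sum.elim (fun x => e3 (e2 x)) (fun x => Sum.inl (x.1, w (Sum.inl x.2)))
  have he3 : Function.Injective e3 := by
    rintro (⟨x, y⟩ | x) (⟨x', y'⟩ | x') h <;> simp [e3] at h ⊢ <;> exact h
  have he4 : Function.Injective e4 := by
    rintro (x | ⟨x, y⟩) (x' | ⟨x', y'⟩) h
    · exact congrArg _ (e2.injective (he3 h))
    · exfalso
      simp only [e4, Sum.elim_inl, Sum.elim_inr] at h
      rcases hx : e2 x with y | y <;> simp [e3, hx] at h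
    · exfalso
      simp only [e4, Sum.elim_inl, Sum.elim_inr] at h
      rcases hx : e2 x' with y | y <;> simp [e3, hx] at h
    · simpa [e4] using h
  have d3 := d2.regroup (Sum.map Prod.fst id : Fin s × Q ⊕ Fin z → Fin s ⊕ Fin z) e4 he4
    (Sum.elim (fun x => Sum.map Prod.fst id (e3 (e2 x))) (fun x => Sum.inl x.1))
    (by rintro (x | x) <;> rfl)
  have d4 := d3.rees (RT.lin Q tQ htQ)
  refine d4.hasMOLS (by simpa using Function.injective_id) ?_ ?_ ?_ hK
  · simp only [Nat.card_prod, hP, hQ, hR]; ring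
  · have := hq.pos
    have := hr.pos
    positivity
  · simp only [Nat.card_sum, Nat.card_prod, Nat.card_fin, hQ]
    have h5 : s * q + z = p * r := by
      rw [hras, hd]; nlinarith
    calc s * (q * q) + z * q = (s * q + z) * q := by ring
      _ = p * q * r := by rw [h5]; ring

theorem molsNum_three_prime_powers : ∀ p q r : ℕ, IsPrimePow p → IsPrimePow q → IsPrimePow r → p ≤ q → q ≤ r → p ≤ molsNum (p * q * r) := by
  intro p q r hp hq hr hpq hqr
  have hp2 := hp.two_le
  refine le_molsNum ?_ ?_
  · have := hq.pos
    have := hr.pos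
    calc 2 ≤ p := hp2
      _ ≤ p * q := Nat.le_mul_of_pos_right _ hq.pos
      _ ≤ p * q * r := Nat.le_mul_of_pos_right _ hr.pos
  rcases hpq.lt_or_eq with h | rfl
  · exact hasMOLS_main hp hq hr h hqr
  rcases hqr.lt_or_eq with h | rfl
  · rw [← sq]
    exact hasMOLS_mul (hp.pow two_ne_zero) hr h (by nlinarith)
  · rw [← sq, ← pow_succ]
    exact hasMOLS_primePow (hp.pow three_ne_zero) (by nlinarith [pow_succ p 2])
end

section
/- N(936) ≥ 8; that is, there exist 8 mutually orthogonal latin squares of order 936 = 8 × 9 × 13 (equivalently, a TD(10, 936) exists). -/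
/-- A family of blocks (indexed by `ι`, each block recorded as its unique point in each of the
`k` groups, the groups being copies of `α`) forms a transversal design: any two points from
distinct groups lie together in exactly one block. -/
def IsTD {α ι : Type*} (k : ℕ) (B : ι → Fin k → α) : Prop :=
  ∀ i j : Fin k, i ≠ j → ∀ x y : α, ∃! b : ι, B b i = x ∧ B b j = y

/-- There exists a transversal design `TD(k,n)`: `kn` points in `k` groups of size `n`,
with `n²` blocks, each block meeting every group exactly once, such that any two points
from distinct groups lie together in exactly one block. -/
def TDExists (k n : ℕ) : Prop :=
  ∃ B : Fin (n ^ 2) → Fin k → Fin n, IsTD k B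

/-- `c` assigns each block of `B` to a class, and for each class index `s` the corresponding
class is a `σ s`-parallel class: it covers every point exactly `σ s` times. -/
def IsResolution {α ι τ : Type*} {k : ℕ} (B : ι → Fin k → α) (σ : τ → ℕ) (c : ι → τ) : Prop :=
  ∀ (s : τ) (i : Fin k) (x : α), Nat.card {b : ι // c b = s ∧ B b i = x} = σ s

/-- There exists a resolvable transversal design `RTD(k,n)`: a `TD(k,n)` whose blocks
partition into `n` parallel classes. -/
def RTDExists (k n : ℕ) : Prop :=
  ∃ (B : Fin (n ^ 2) → Fin k → Fin n) (c : Fin (n ^ 2) → Fin n),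
    IsTD k B ∧ IsResolution B (fun _ => 1) c

section Construction

variable {A F : Type} [Field A] [Field F]

/-- Blocks of the design. -/
abbrev Blk (A F : Type) := F × Option A × A × A × ZMod 13 × ZMod 13

/-- Points of the tenth group. -/
abbrev Cls := (Fin 59 × ZMod 13) ⊕ (ZMod 13 × ZMod 13)

/-- Coordinate in the field of order 8. -/
def coordA (i d : Option A) (u u2 : A) : A :=
  match i with
  | some r => u + r * u2
  | none => u2 + d.getD 0

/-- The shift used in the cyclic coordinate. -/
def ell (lam : A ⊕ Fin 5 → ZMod 13) (E : A × A → Fin 5 ⊕ Fin 59)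
    (i d : Option A) (u u2 : A) : ZMod 13 :=
  match d with
  | none => (match i with
    | some _ => lam (Sum.inl u2)
    | none => lam (Sum.inl u))
  | some c => (match E (u - c, u2) with
    | Sum.inl f => lam (Sum.inr f)
    | Sum.inr _ => 0)

/-- Coordinate in the tenth group. -/
def clsOf (E : A × A → Fin 5 ⊕ Fin 59) (d : Option A) (u u2 : A) (w w2 : ZMod 13) : Cls :=
  match d with
  | none => Sum.inr (w, w2)
  | some c => (match E (u - c, u2) with
    | Sum.inl _ => Sum.inr (w, w2)
    | Sum.inr k => Sum.inl (k, w2))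

/-- Coordinates in the first nine groups. -/
def pt (e : Option A → F) (t : Option A → ZMod 13) (lam : A ⊕ Fin 5 → ZMod 13)
    (E : A × A → Fin 5 ⊕ Fin 59) (i : Option A) : Blk A F → A × F × ZMod 13
  | (v, d, u, u2, w, w2) =>
    (coordA i d u u2, v + e i * e d, w + t i * w2 + ell lam E i d u u2)

/-- Tenth coordinate of a block. -/
def pt10 (E : A × A → Fin 5 ⊕ Fin 59) : Blk A F → Cls
  | (_, d, u, u2, w, w2) => clsOf E d u u2 w w2

theorem solve_two {K : Type} [Field K] {a b x y x2 y2 : K} (hab : a ≠ b)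
    (h1 : x + a * y = x2 + a * y2) (h2 : x + b * y = x2 + b * y2) : x = x2 ∧ y = y2 := by
  have h : (a - b) * (y - y2) = 0 := by linear_combination h1 - h2
  have hy : y = y2 := by
    rcases mul_eq_zero.1 h with h | h
    · exact absurd (sub_eq_zero.1 h) hab
    · exact sub_eq_zero.1 h
  subst hy
  exact ⟨add_right_cancel h1, rfl⟩

theorem coordA_two {i j d : Option A} (hij : i ≠ j) {u u2 x x2 : A}
    (h1 : coordA i d u u2 = coordA i d x x2) (h2 : coordA j d u u2 = coordA j d x x2) :
    u = x ∧ u2 = x2 := by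
  cases i with
  | none =>
    cases j with
    | none => exact absurd rfl hij
    | some r =>
      simp only [coordA] at h1 h2
      have h := add_right_cancel h1
      subst h
      exact ⟨add_right_cancel h2, rfl⟩
  | some q =>
    cases j with
    | none =>
      simp only [coordA] at h1 h2
      have h := add_right_cancel h2
      subst h
      exact ⟨add_right_cancel h1, rfl⟩
    | some r =>
      simp only [coordA] at h1 h2
      exact solve_two (fun h => hij (by rw [h])) h1 h2

instance : Fact (Nat.Prime 13) := ⟨by norm_num⟩

theorem pt_pair_injective (e : Option A → F) (t : Option A → ZMod 13)
    (lam : A ⊕ Fin 5 → ZMod 13) (E : A × A → Fin 5 ⊕ Fin 59)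
    (he : Function.Injective e) (ht : Function.Injective t)
    {i j : Option A} (hij : i ≠ j) {b c : Blk A F}
    (h1 : pt e t lam E i b = pt e t lam E i c) (h2 : pt e t lam E j b = pt e t lam E j c) :
    b = c := by
  obtain ⟨v, d, u, u2, w, w2⟩ := b
  obtain ⟨vp, dp, x, x2, y, y2⟩ := c
  simp only [pt, Prod.mk.injEq] at h1 h2
  obtain ⟨h1a, h1f, h1z⟩ := h1
  obtain ⟨h2a, h2f, h2z⟩ := h2
  obtain ⟨rfl, hd⟩ := solve_two (fun h => hij (he h)) h1f h2f
  obtain rfl := he hd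
  obtain ⟨rfl, rfl⟩ := coordA_two hij h1a h2a
  obtain ⟨rfl, rfl⟩ := solve_two (fun h => hij (ht h))
    (add_right_cancel h1z) (add_right_cancel h2z)
  rfl

theorem coordA_some {i : Option A} {c cp u u2 x x2 : A} (h : (u - c, u2) = (x - cp, x2))
    (h1 : coordA i (some c) u u2 = coordA i (some cp) x x2) : c = cp ∧ u = x ∧ u2 = x2 := by
  simp only [Prod.mk.injEq] at h
  obtain ⟨h, rfl⟩ := h
  cases i with
  | none =>
    simp only [coordA, Option.getD_some] at h1
    have := add_left_cancel h1
    subst this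
    exact ⟨rfl, sub_left_injective h, rfl⟩
  | some r =>
    simp only [coordA] at h1
    have := add_right_cancel h1
    subst this
    exact ⟨sub_right_injective h, rfl, rfl⟩

theorem pt_ten_injective (e : Option A → F) (t : Option A → ZMod 13)
    (lam : A ⊕ Fin 5 → ZMod 13) (E : A × A → Fin 5 ⊕ Fin 59)
    (hl : Function.Injective lam) (hE : Function.Injective E)
    {i : Option A} {b c : Blk A F}
    (h1 : pt e t lam E i b = pt e t lam E i c) (h2 : pt10 E b = pt10 E c) :
    b = c := by
  obtain ⟨v, d, u, u2, w, w2⟩ := b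
  obtain ⟨vp, dp, x, x2, y, y2⟩ := c
  simp only [pt, pt10, Prod.mk.injEq] at h1 h2
  obtain ⟨h1a, h1f, h1z⟩ := h1
  have key : d = dp ∧ u = x ∧ u2 = x2 ∧ w2 = y2 := by
    cases d with
    | none =>
      cases dp with
      | none =>
        simp only [clsOf, Sum.inr.injEq, Prod.mk.injEq] at h2
        obtain ⟨rfl, rfl⟩ := h2
        have h3 := add_left_cancel h1z
        cases i with
        | none =>
          simp only [ell, coordA] at h3 h1a
          have h4 := Sum.inl.inj (hl h3)
          have h5 := add_right_cancel h1a
          exact ⟨rfl, h4, h5, rfl⟩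
        | some r =>
          simp only [ell, coordA] at h3 h1a
          have h4 := Sum.inl.inj (hl h3)
          subst h4
          exact ⟨rfl, add_right_cancel h1a, rfl, rfl⟩
      | some cp =>
        exfalso
        rcases hF : E (x - cp, x2) with f | k
        · simp only [clsOf, hF, Sum.inr.injEq, Prod.mk.injEq] at h2
          obtain ⟨rfl, rfl⟩ := h2
          have h3 := add_left_cancel h1z
          cases i <;> simp only [ell, hF] at h3 <;> exact absurd (hl h3) (by simp)
        · simp [clsOf, hF] at h2
    | some c =>
      rcases hG : E (u - c, u2) with g | k
      · cases dp with
        | none =>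
          exfalso
          simp only [clsOf, hG, Sum.inr.injEq, Prod.mk.injEq] at h2
          obtain ⟨rfl, rfl⟩ := h2
          have h3 := add_left_cancel h1z
          cases i <;> simp only [ell, hG] at h3 <;> exact absurd (hl h3) (by simp)
        | some cp =>
          rcases hF : E (x - cp, x2) with f | k
          · simp only [clsOf, hF, hG, Sum.inr.injEq, Prod.mk.injEq] at h2
            obtain ⟨rfl, rfl⟩ := h2
            have h3 := add_left_cancel h1z
            simp only [ell, hF, hG] at h3
            have h4 := Sum.inr.inj (hl h3)
            subst h4
            obtain ⟨rfl, rfl, rfl⟩ := coordA_some (hE (hG.trans hF.symm)) h1a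
            exact ⟨rfl, rfl, rfl, rfl⟩
          · simp [clsOf, hF, hG] at h2
      · cases dp with
        | none => simp [clsOf, hG] at h2
        | some cp =>
          rcases hF : E (x - cp, x2) with f | k2
          · simp [clsOf, hF, hG] at h2
          · simp only [clsOf, hF, hG, Sum.inl.injEq, Prod.mk.injEq] at h2
            obtain ⟨rfl, rfl⟩ := h2
            obtain ⟨rfl, rfl, rfl⟩ := coordA_some (hE (hG.trans hF.symm)) h1a
            exact ⟨rfl, rfl, rfl, rfl⟩
  obtain ⟨rfl, rfl, rfl, rfl⟩ := key
  obtain rfl := add_right_cancel h1f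
  obtain rfl := add_right_cancel (add_right_cancel h1z)
  rfl

end Construction

/-- A family of blocks of the right size is a transversal design as soon as pairs of
coordinates separate blocks. -/
theorem tdExists_of_injective {k n : ℕ} {ι : Type} [Fintype ι] (hι : Fintype.card ι = n ^ 2)
    (B : ι → Fin k → Fin n)
    (hB : ∀ i j : Fin k, i ≠ j → ∀ b c, B b i = B c i → B b j = B c j → b = c) :
    TDExists k n := by
  let q : Fin (n ^ 2) ≃ ι := (Fintype.equivFinOfCardEq hι).symm
  refine ⟨fun b => B (q b), ?_⟩
  intro i j hij x y
  have hinj : Function.Injective fun b : ι => (B b i, B b j) := by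
    intro b c h
    simp only [Prod.mk.injEq] at h
    exact hB i j hij b c h.1 h.2
  have hbij : Function.Bijective fun b : ι => (B b i, B b j) := by
    rw [Fintype.bijective_iff_injective_and_card]
    refine ⟨hinj, ?_⟩
    rw [hι, Fintype.card_prod, Fintype.card_fin, sq]
  obtain ⟨b, hb⟩ := hbij.2 (x, y)
  simp only [Prod.mk.injEq] at hb
  refine ⟨q.symm b, by simpa using hb, ?_⟩
  intro c hc
  apply q.injective
  rw [Equiv.apply_symm_apply]
  exact hB i j hij _ _ (hc.1.trans hb.1.symm) (hc.2.trans hb.2.symm)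

theorem td_ten : TDExists 10 936 := by
  haveI : Fact (Nat.Prime 2) := ⟨Nat.prime_two⟩
  haveI : Fact (Nat.Prime 3) := ⟨Nat.prime_three⟩
  let A := GaloisField 2 3
  let F := GaloisField 3 2
  letI : Fintype A := Fintype.ofFinite A
  letI : Fintype F := Fintype.ofFinite F
  have hA : Fintype.card A = 8 := by
    rw [← Nat.card_eq_fintype_card, GaloisField.card 2 3 (by norm_num)]; norm_num
  have hF : Fintype.card F = 9 := by
    rw [← Nat.card_eq_fintype_card, GaloisField.card 3 2 (by norm_num)]; norm_num
  have hZ : Fintype.card (ZMod 13) = 13 := ZMod.card 13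
  let e : Option A ≃ F := Fintype.equivOfCardEq (by rw [Fintype.card_option, hA, hF])
  obtain ⟨t⟩ : Nonempty (Option A ↪ ZMod 13) :=
    Function.Embedding.nonempty_of_card_le (by rw [Fintype.card_option, hA, hZ]; norm_num)
  let lam : A ⊕ Fin 5 ≃ ZMod 13 :=
    Fintype.equivOfCardEq (by rw [Fintype.card_sum, hA, hZ, Fintype.card_fin])
  let E : A × A ≃ Fin 5 ⊕ Fin 59 :=
    Fintype.equivOfCardEq (by rw [Fintype.card_sum, Fintype.card_prod, hA]; simp)
  let g : A × F × ZMod 13 ≃ Fin 936 :=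
    Fintype.equivFinOfCardEq (by rw [Fintype.card_prod, Fintype.card_prod, hA, hF, hZ])
  let g10 : Cls ≃ Fin 936 :=
    Fintype.equivFinOfCardEq (by
      rw [Fintype.card_sum, Fintype.card_prod, Fintype.card_prod, hZ, Fintype.card_fin])
  let s : Fin 10 ≃ Option (Option A) :=
    (Fintype.equivFinOfCardEq (by rw [Fintype.card_option, Fintype.card_option, hA])).symm
  let C : Blk A F → Option (Option A) → Fin 936 := fun b i =>
    match i with
    | some i => g (pt e t lam E i b)
    | none => g10 (pt10 E b)
  refine tdExists_of_injective (ι := Blk A F) ?_ (fun b i => C b (s i)) ?_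
  · simp only [Blk, Fintype.card_prod, Fintype.card_option, hA, hF, hZ]
    norm_num
  · intro i j hij b c h1 h2
    have hs : s i ≠ s j := fun h => hij (s.injective h)
    generalize s i = ip at *
    generalize s j = jp at *
    cases ip with
    | none =>
      cases jp with
      | none => exact absurd rfl hs
      | some jp =>
        exact pt_ten_injective e t lam E lam.injective E.injective
          (g.injective h2) (g10.injective h1)
    | some ip =>
      cases jp with
      | none =>
        exact pt_ten_injective e t lam E lam.injective E.injective
          (g.injective h1) (g10.injective h2)
      | some jp =>
        exact pt_pair_injective e t lam E e.injective t.injective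
          (fun h => hs (by rw [h])) (g.injective h1) (g.injective h2)

theorem hasMOLS_of_td {n r : ℕ} (h : TDExists (r + 2) n) : HasMOLS n r := by
  obtain ⟨B, hB⟩ := h
  have h01 : (0 : Fin (r + 2)) ≠ 1 := by simp
  choose b hb _ using hB 0 1 h01
  have uniq : ∀ i j : Fin (r + 2), i ≠ j → ∀ x y, B x i = B y i → B x j = B y j → x = y := by
    intro i j hij x y h1 h2
    exact (hB i j hij (B y i) (B y j)).unique ⟨h1, h2⟩ ⟨rfl, rfl⟩
  have hs0 : ∀ s : Fin r, s.succ.succ ≠ (0 : Fin (r + 2)) := fun s => Fin.succ_ne_zero _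
  have hs1 : ∀ s : Fin r, s.succ.succ ≠ (1 : Fin (r + 2)) := by
    intro s h
    have := congrArg Fin.val h
    simp at this
  refine ⟨fun s x y => B (b x y) s.succ.succ, ?_, ?_⟩
  · intro s
    constructor
    · intro x
      rw [← Finite.injective_iff_bijective]
      intro y z h
      have h2 := uniq 0 s.succ.succ (hs0 s).symm (b x y) (b x z)
        ((hb x y).1.trans (hb x z).1.symm) h
      rw [← (hb x y).2, ← (hb x z).2, h2]
    · intro x
      rw [← Finite.injective_iff_bijective]
      intro y z h
      have h2 := uniq 1 s.succ.succ (hs1 s).symm (b y x) (b z x)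
        ((hb y x).2.trans (hb z x).2.symm) h
      rw [← (hb y x).1, ← (hb z x).1, h2]
  · intro s t hst p q h
    simp only [Prod.mk.injEq] at h
    have h2 := uniq s.succ.succ t.succ.succ
      (fun h => hst (Fin.succ_injective _ (Fin.succ_injective _ h))) _ _ h.1 h.2
    apply Prod.ext
    · rw [← (hb p.1 p.2).1, ← (hb q.1 q.2).1, h2]
    · rw [← (hb p.1 p.2).2, ← (hb q.1 q.2).2, h2]

theorem bddAbove_mols {n : ℕ} (hn : 2 ≤ n) : BddAbove {r | HasMOLS n r} := by
  refine ⟨Fintype.card (Fin n → Fin n → Fin n), ?_⟩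
  rintro r ⟨L, -, hL⟩
  have hinj : Function.Injective L := by
    intro s t hst
    by_contra hne
    have h := hL s t hne
    rw [hst] at h
    have h2 : Function.Injective fun p : Fin n × Fin n => L t p.1 p.2 := by
      intro p q hpq
      apply h
      simp only [Prod.mk.injEq]
      exact ⟨hpq, hpq⟩
    have h3 := Fintype.card_le_of_injective _ h2
    rw [Fintype.card_prod, Fintype.card_fin] at h3
    nlinarith
  have h := Fintype.card_le_of_injective L hinj
  rwa [Fintype.card_fin] at h

/-- `N(936) ≥ 8`: there exist 8 MOLS of order `936 = 8 × 9 × 13`;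
equivalently, a `TD(10, 936)` exists. -/
theorem molsNum_936 : 8 ≤ molsNum (8 * 9 * 13) ∧ TDExists 10 936 := by
  refine ⟨?_, td_ten⟩
  have h : HasMOLS 936 8 := hasMOLS_of_td td_ten
  have h2 : 8 ≤ molsNum 936 := le_csSup (bddAbove_mols (by norm_num)) h
  norm_num
  exact h2
end

section
/- N(7429) ≥ 17; that is, there exist 17 mutually orthogonal latin squares of order 7429 = 17 × 19 × 23. -/
/-! The construction: a resolvable transversal design with 18 groups of size `19 * 17 * 23`, built by
twisting the triple product of the affine designs over `F_19`, `F_17`, `F_23`.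
The block with coordinates `(u, v, m, b, p, q)` meets each group once (`ptCol`)
and lies in one parallel class (`clsCol`). -/

namespace TripleProduct

instance : Fact (Nat.Prime 17) := ⟨by norm_num⟩
instance : Fact (Nat.Prime 19) := ⟨by norm_num⟩
instance : Fact (Nat.Prime 23) := ⟨by norm_num⟩

theorem molsBound {n r : ℕ} (hn : 2 ≤ n) (h : HasMOLS n r) : r ≤ n := by
  obtain ⟨L, hL, hO⟩ := h
  let z : Fin n := ⟨0, by omega⟩
  let o : Fin n := ⟨1, by omega⟩
  have key : ∀ s, ∃ j, L s o j = L s z z := fun s => ((hL s).1 o).2 (L s z z)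
  choose g hg using key
  have hinj : Function.Injective g := by
    intro s t hst
    by_contra hne
    have h1 := hg t
    rw [← hst] at h1
    have := @hO s t hne (o, g s) (z, z) (by simp [hg s, h1])
    simp [o, z] at this
  simpa using Fintype.card_le_of_injective g hinj

theorem molsOfArray {n r : ℕ} {B : Type} [Fintype B]
    (hB : Fintype.card B = n * n) (f : Fin (r + 1) → B → Fin n) (h : B → Fin n)
    (hf : ∀ x y, x ≠ y → ∀ a b, f x a = f x b → f y a = f y b → a = b)
    (hh : ∀ x, ∀ a b, f x a = f x b → h a = h b → a = b) : HasMOLS n r := by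
  have hbij : Function.Bijective (fun a : B => (h a, f 0 a)) := by
    rw [Fintype.bijective_iff_injective_and_card]
    refine ⟨?_, by simp [hB]⟩
    intro a b hab
    simp only [Prod.mk.injEq] at hab
    exact hh 0 a b hab.2 hab.1
  let e := Equiv.ofBijective _ hbij
  have e1 : ∀ p, h (e.symm p) = p.1 := fun p => congrArg Prod.fst (e.apply_symm_apply p)
  have e2 : ∀ p, f 0 (e.symm p) = p.2 := fun p => congrArg Prod.snd (e.apply_symm_apply p)
  refine ⟨fun s i j => f s.succ (e.symm (i, j)), ?_, ?_⟩
  · intro s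
    constructor
    · intro i
      rw [← Finite.injective_iff_bijective]
      intro j j' hj
      have := hh s.succ _ _ hj (by rw [e1, e1])
      simpa using this
    · intro j
      rw [← Finite.injective_iff_bijective]
      intro i i' hj
      have := hf s.succ 0 (Fin.succ_ne_zero s) _ _ hj (by rw [e2, e2])
      simpa using this
  · intro s t hst p p' hp
    simp only [Prod.mk.injEq] at hp
    have := hf s.succ t.succ (by simpa using hst) _ _ hp.1 hp.2
    simpa using this

/-- Blocks. -/
structure Blk where
  u : ZMod 19
  v : ZMod 19
  m : ZMod 17
  b : ZMod 17
  p : ZMod 23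
  q : ZMod 23

def blkEquiv : Blk ≃ ZMod 19 × ZMod 19 × ZMod 17 × ZMod 17 × ZMod 23 × ZMod 23 where
  toFun a := (a.u, a.v, a.m, a.b, a.p, a.q)
  invFun a := ⟨a.1, a.2.1, a.2.2.1, a.2.2.2.1, a.2.2.2.2.1, a.2.2.2.2.2⟩
  left_inv _ := rfl
  right_inv _ := rfl

noncomputable instance : Fintype Blk := Fintype.ofEquiv _ blkEquiv.symm

theorem cardBlk : Fintype.card Blk = (17 * 19 * 23) * (17 * 19 * 23) := by
  rw [Fintype.card_congr blkEquiv]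
  simp [ZMod.card]

/-- Index of the pair `(m, b)`. -/
def idx (a : Blk) : ℕ := a.m.val * 17 + a.b.val

/-- The evaluation of a block of the design over `F_17` in group `x` (`x = 17` is infinity). -/
def ev (x : Fin 18) (m b : ZMod 17) : ZMod 17 := if x.val = 17 then m else m * (x.val : ZMod 17) + b

/-- Label of the flag, below 23. -/
def lab (x : Fin 18) (a : Blk) : ℕ :=
  if a.u.val < 17 then (if idx a < 277 then 0 else 17 + (idx a - 277) % 6)
  else if x.val = 17 then a.b.val else a.m.val

def ptCol (x : Fin 18) (a : Blk) : ZMod 19 × ZMod 17 × ZMod 23 :=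
  (a.u * (x.val : ZMod 19) + a.v, ev x a.m a.b + (a.u.val : ZMod 17),
    a.p * (x.val : ZMod 23) + a.q + (lab x a : ZMod 23))

def clsCol (a : Blk) : ℕ :=
  if a.u.val < 17 then
    (if idx a < 277 then 23 * idx a + a.p.val
     else 6371 + 529 * ((idx a - 277) / 6) + 23 * a.p.val + a.q.val)
  else 6371 + 529 * (a.u.val - 17) + 23 * a.p.val + a.q.val

theorem idx_lt (a : Blk) : idx a < 289 := by
  have h1 := ZMod.val_lt a.m
  have h2 := ZMod.val_lt a.b
  unfold idx; omega

theorem idx_inj {a c : Blk} (h : idx a = idx c) : a.m = c.m ∧ a.b = c.b := by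
  have h1 := ZMod.val_lt a.m
  have h2 := ZMod.val_lt a.b
  have h3 := ZMod.val_lt c.m
  have h4 := ZMod.val_lt c.b
  unfold idx at h
  exact ⟨ZMod.val_injective _ (by omega), ZMod.val_injective _ (by omega)⟩

theorem lab_lt (x : Fin 18) (a : Blk) : lab x a < 23 := by
  have h1 := ZMod.val_lt a.m
  have h2 := ZMod.val_lt a.b
  unfold lab; split_ifs <;> omega

theorem clsCol_lt (a : Blk) : clsCol a < 17 * 19 * 23 := by
  have h1 := ZMod.val_lt a.u
  have h2 := ZMod.val_lt a.p
  have h3 := ZMod.val_lt a.q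
  have := idx_lt a
  unfold clsCol; split_ifs <;> omega

theorem castInj {n : ℕ} {s t : ℕ} (hs : s < n) (ht : t < n)
    (h : (s : ZMod n) = (t : ZMod n)) : s = t := by
  rw [ZMod.natCast_eq_natCast_iff'] at h
  rwa [Nat.mod_eq_of_lt hs, Nat.mod_eq_of_lt ht] at h

theorem line {F : Type} [Field F] {x y u v u' v' : F} (hxy : x ≠ y)
    (h1 : u * x + v = u' * x + v') (h2 : u * y + v = u' * y + v') : u = u' ∧ v = v' := by
  have h3 : (u - u') * (x - y) = 0 := by linear_combination h1 - h2
  have h4 : u = u' := by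
    rcases mul_eq_zero.1 h3 with h | h
    · exact sub_eq_zero.1 h
    · exact absurd (sub_eq_zero.1 h) hxy
  subst h4
  exact ⟨rfl, add_left_cancel h1⟩

theorem evLine {x y : Fin 18} (hxy : x ≠ y) {m b m' b' : ZMod 17}
    (h1 : ev x m b = ev x m' b') (h2 : ev y m b = ev y m' b') : m = m' ∧ b = b' := by
  have hne : x.val ≠ y.val := fun h => hxy (Fin.ext h)
  have hx := x.isLt
  have hy := y.isLt
  unfold ev at h1 h2
  split_ifs at h1 h2 with hx' hy' hy'
  · omega
  · subst h1; exact ⟨rfl, add_left_cancel h2⟩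
  · subst h2; exact ⟨rfl, add_left_cancel h1⟩
  · exact line (fun h => hne (castInj (by omega) (by omega) h)) h1 h2

theorem Blk.ext' {a c : Blk} (h1 : a.u = c.u) (h2 : a.v = c.v) (h3 : a.m = c.m) (h4 : a.b = c.b)
    (h5 : a.p = c.p) (h6 : a.q = c.q) : a = c := by
  cases a; cases c; simp_all

theorem ptPt (x y : Fin 18) (hxy : x ≠ y) (a c : Blk) (h1 : ptCol x a = ptCol x c)
    (h2 : ptCol y a = ptCol y c) : a = c := by
  have hne : x.val ≠ y.val := fun h => hxy (Fin.ext h)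
  have hx := x.isLt
  have hy := y.isLt
  simp only [ptCol, Prod.mk.injEq] at h1 h2
  obtain ⟨a1, a2, a3⟩ := h1
  obtain ⟨b1, b2, b3⟩ := h2
  obtain ⟨hu, hv⟩ := line (fun h => hne (castInj (by omega) (by omega) h)) a1 b1
  rw [hu] at a2 b2
  obtain ⟨hm, hb⟩ := evLine hxy (add_right_cancel a2) (add_right_cancel b2)
  have hl : ∀ z, lab z a = lab z c := fun z => by
    cases a; cases c; dsimp only at hu hm hb; subst hu hm hb; rfl
  rw [hl] at a3 b3
  obtain ⟨hp, hq⟩ := line (fun h => hne (castInj (by omega) (by omega) h))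
    (add_right_cancel a3) (add_right_cancel b3)
  exact Blk.ext' hu hv hm hb hp hq

theorem ptCls (x : Fin 18) (a c : Blk) (h1 : ptCol x a = ptCol x c)
    (h2 : clsCol a = clsCol c) : a = c := by
  simp only [ptCol, Prod.mk.injEq] at h1
  obtain ⟨a1, a2, a3⟩ := h1
  have ap := ZMod.val_lt a.p
  have aq := ZMod.val_lt a.q
  have cp := ZMod.val_lt c.p
  have cq := ZMod.val_lt c.q
  have au := ZMod.val_lt a.u
  have cu := ZMod.val_lt c.u
  have ai := idx_lt a
  have ci := idx_lt c
  -- once `u` agrees, so does `v`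
  have hvu : a.u = c.u → a.v = c.v := fun h => by rw [h] at a1; exact add_left_cancel a1
  -- if `idx` agrees and both `u` are small then all of `u, v, m, b` agree
  have small : a.u.val < 17 → c.u.val < 17 → idx a = idx c →
      a.u = c.u ∧ a.v = c.v ∧ a.m = c.m ∧ a.b = c.b := by
    intro ha hc hi
    obtain ⟨hm, hb⟩ := idx_inj hi
    rw [hm, hb] at a2
    have hu : a.u = c.u := ZMod.val_injective _ (castInj ha hc (add_left_cancel a2))
    exact ⟨hu, hvu hu, hm, hb⟩
  -- if `p, q` agree then the labels agree
  have labEq : a.p = c.p → a.q = c.q → lab x a = lab x c := by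
    intro hp hq
    rw [hp, hq] at a3
    exact castInj (lab_lt x a) (lab_lt x c) (add_left_cancel a3)
  have pq : a.p.val = c.p.val → a.q.val = c.q.val → a.p = c.p ∧ a.q = c.q := fun h h' =>
    ⟨ZMod.val_injective _ h, ZMod.val_injective _ h'⟩
  have am := ZMod.val_lt a.m
  have ab := ZMod.val_lt a.b
  have cm := ZMod.val_lt c.m
  have cb := ZMod.val_lt c.b
  by_cases ha : a.u.val < 17 <;> by_cases hc : c.u.val < 17
  · by_cases ia : idx a < 277 <;> by_cases ic : idx c < 277 <;>
      simp only [clsCol, ha, hc, ia, ic, if_true, if_false] at h2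
    · obtain ⟨hu, hv, hm, hb⟩ := small ha hc (by omega)
      have hp : a.p = c.p := ZMod.val_injective _ (by omega)
      simp only [lab, ha, hc, ia, ic, if_true, hp] at a3
      exact Blk.ext' hu hv hm hb hp (add_left_cancel (add_right_cancel a3))
    · omega
    · omega
    · obtain ⟨hp, hq⟩ := pq (by omega) (by omega)
      have hl := labEq hp hq
      simp only [lab, ha, hc, ia, ic, if_true, if_false] at hl
      obtain ⟨hu, hv, hm, hb⟩ := small ha hc (by omega)
      exact Blk.ext' hu hv hm hb hp hq
  · exfalso
    by_cases ia : idx a < 277 <;> simp only [clsCol, ha, hc, ia, if_true, if_false] at h2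
    · omega
    · obtain ⟨hp, hq⟩ := pq (by omega) (by omega)
      have hl := labEq hp hq
      simp only [lab, ha, hc, ia, if_true, if_false] at hl
      split_ifs at hl <;> omega
  · exfalso
    by_cases ic : idx c < 277 <;> simp only [clsCol, ha, hc, ic, if_true, if_false] at h2
    · omega
    · obtain ⟨hp, hq⟩ := pq (by omega) (by omega)
      have hl := labEq hp hq
      simp only [lab, ha, hc, ic, if_true, if_false] at hl
      split_ifs at hl <;> omega
  · simp only [clsCol, ha, hc, if_false] at h2
    obtain ⟨hp, hq⟩ := pq (by omega) (by omega)
    have hu : a.u = c.u := ZMod.val_injective _ (by omega)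
    have hl := labEq hp hq
    simp only [lab, ha, hc, if_false] at hl
    rw [hu] at a2
    have a4 := add_right_cancel a2
    unfold ev at a4
    split_ifs at hl a4 with hx
    · exact Blk.ext' hu (hvu hu) a4 (ZMod.val_injective _ hl) hp hq
    · have hm : a.m = c.m := ZMod.val_injective _ hl
      rw [hm] at a4
      exact Blk.ext' hu (hvu hu) hm (add_left_cancel a4) hp hq

theorem hasMOLS : HasMOLS (17 * 19 * 23) 17 := by
  have hc : Fintype.card (ZMod 19 × ZMod 17 × ZMod 23) = 17 * 19 * 23 := by
    simp [ZMod.card]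
  let e := Fintype.equivFinOfCardEq hc
  refine molsOfArray cardBlk (fun x a => e (ptCol x a)) (fun a => ⟨clsCol a, clsCol_lt a⟩) ?_ ?_
  · intro x y hxy a b h1 h2
    exact ptPt x y hxy a b (e.injective h1) (e.injective h2)
  · intro x a b h1 h2
    exact ptCls x a b (e.injective h1) (Fin.mk.inj h2)

end TripleProduct

theorem molsNum_7429 : 17 ≤ molsNum (17 * 19 * 23) := by
  unfold molsNum
  refine le_csSup ⟨17 * 19 * 23, fun r hr => TripleProduct.molsBound (by norm_num) hr⟩ ?_
  exact TripleProduct.hasMOLS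
end
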